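/- arXiv:1403.1801 — 2 statements merged into one kernel-verified Lean document; each statement's English description precedes it below -/
import Mathlib

section
/- For every integer k with 17 ≤ k ≤ 31, there are no integers x and y such that s_{k,k}·x² + s_{2k}·y = 1 or s_{k,k}·x² + s_{2k}·y = −1. (This is the arithmetic content of the nonexistence of an n-dimensional rational projective plane for 128 < n < 256.) -/
open Nat

/-- `wt k` is the Hamming weight of `k`, i.e. the number of ones in its binary expansion. -/
def wt (k : ℕ) : ℕ := (Nat.digits 2 k).sum

/-- `sL k = 2^(2k) * (2^(2k-1) - 1) * |B_(2k)| / (2k)!` is the coefficient of `p_k`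
in the k-th Hirzebruch L-polynomial. -/
noncomputable def sL (k : ℕ) : ℚ :=
  2 ^ (2 * k) * (2 ^ (2 * k - 1) - 1) * |bernoulli (2 * k)| / ((2 * k)! : ℚ)

/-- `sLL k = (sL k ^ 2 - sL (2k)) / 2` is the coefficient of `p_k ^ 2`
in the 2k-th Hirzebruch L-polynomial. -/
noncomputable def sLL (k : ℕ) : ℚ := (sL k ^ 2 - sL (2 * k)) / 2

/-- A common denominator of the Bernoulli numbers `B_0, B_2, …, B_124`. -/
def bernoulliDenom : ℕ := 31610054640417607788145206291543662493274686990

/-- The integers `bernoulliDenom * B_(2j)` for `0 ≤ j ≤ 62`. -/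
def bernoulliTable : List ℤ :=
  [31610054640417607788145206291543662493274686990,
    5268342440069601298024201048590610415545781165,
    -1053668488013920259604840209718122083109156233,
    752620348581371614003457292655801487935111595,
    -1053668488013920259604840209718122083109156233,
    2394701109122546044556455022086641097975355075,
    -8000933244149658235021369065002443510202494033,
    36878397080487209086169407340134272908820468155,
    -224183465949785269352394531679438092623871652633,
    1737641938485212031131034792470107572171028438835,
    -16725646214599875495441886714462819550342989000033,
    195733352325704139738198004810187316435620526115115,
    -2736806531700600631955846982090915301111232602088233,
    45060675529186627070934688061303495717035867519704995,
    -862898575640412166034438465533542327167765693403653233,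
    19016004294629480053866961310372678613128532250166776475,
    -477827567359589283539223392385707151754647137579875615033,
    13580142341486985616323566109477766265793448574650896257555,
    -433426170243408698956458084423444219822799853869530977077633,
    15436211285437120095070341597822654356754404896976340696436235,
    -609965927371879199601358353561956207580188085016091268896329033,
    26605963224263724458080029888724681507062917295535131142890960515,
    -1275088655395910984381017954827228527530814630732399690932426841233,
    66857632013551005680944794271501742213529262303862610509475122838395,
    -3820589247881138324430828388165603188246493345207441511206238567270233,
    237102807693984269652643448401800361580037077916217465043419911466437875,
    -15927605110875628627941827818441217505773355545516504443540840608985456033,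
    1154676620632702710636575269616534627741397721050117562006985852205787486955,
    -90084765483512838110182957859959566643260222233954269143790468178157026422633,
    7543874672819244409519566525868009110085897236453462563896886755496232671073635,
    -676453565323056997444238663807389960394000210083590897735220274061923005984378033,
    64803696280101756215517746232815417262567997074946892648512772433712416633437645915,
    -6618515109190458918144236953586474750003978188563714466055855600927169781200398714233,
    719213979217169559741889749917899137489516158933562748223827862919215333566301967011795,
    -83000765688028846330007876772486309086187836061647090348686281797990504026714279174007233,
    10154756005948187848946495098329786303851094054683388847738071159733993409485596008250339275,
    -1314923845799671610587807227206255917973769088946305225192063134960679988874543200002364017033,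
    179926629435770686570259614621023148121624235771517925025293346309075878008403480164836790156355,
    -25978290165072224583662649230493210474211427299748313165140676988531608773022878433818562499687633,
    3952174889456623958848670329031589916430642252323729669845418471982774156492973810085856712168351035,
    -632693679662807512523814606473975821444256942552007448169426346884490181211237667784548848266381147033,
    106446804996979730015818999663351321610903729860076111976892734835961730795095404249260068167695302171315,
    -18798806271227753341583848533174590596919724122801505905947494193825906021990237191939255485577544293707233,
    3480870870252591132040196713743104269488935103001213081833718508140116350166375341540234465733546161108225195,
    -675040921085762847928756617320215186582898501658382978551836899416482964945789702397440872857126725030647864233,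
    136962880125675392729219766902286027489852406448810137272587745027682817455291726434485806063499497124211494480675,
    -29045065683828027022538512443508447912740309813003522923032013874166381503094525060042684591181209576123963083298033,
    6431665188626989259171253701381956407583235207526043165102721984902114315712198906904673433480477412375044136800265755,
    -1485793759722626093599669799711571116396954120010637554182366186238577767690781756355074356895929191091211404066116872633,
    357763971734377483794822814342162886843840526241095720165946796932237361933816405176477626725622488685797571846414004268435,
    -89716445974759726815229086578429645922711178888389688751661327184756964794586762729746565240370011899810206357863820454636033,
    23411749571491425252558615922018855942011326507698174443729749781661940705477875322809181575697088633641524896042599221220536715,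
    -6352500343938191263829565079918056193467376349058540281560797155962164142337880535781338190881409706213188283415521218970127820233,
    1790936241077407860603313016506624549942550700032595534502322494053223732789647839809432063997747920963487466649256232700955202478595,
    -524237303766861099732628188328613149881377449545339192812203141038920164642182734250112973055230954826410231890393565032732086652841233,
    159216241521060617332256160332048184481567489226427956857478570313086070696014780745587199522492138799284024089761347207080485561774862075,
    -50138187766962364944634422422876061504526417231746507510414893917053820528501444408737923421829684171547492200093662963664657790592455299033,
    16360334937607025508833352998128928969179337898705834661210713878458953051447851800354708248731002731622170169890017711542258028144028313815155,
    -5528257749712559385376306199500032530424993708750159294612477857640267468062759665077948954525881309163538567943298629479664412354351644837977633,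
    1933287378876792209600918267403250903389730078386686392028978478472342310945020572177325864867037825916689298777540558410790155643329940142594825835,
    -699302187008463816815980905535349663349315917604292156251780438110817488999361840747462116589624868717046637891850814383271752057033157106096812845033,
    261487149461622031778588495248354548195464326799133557598284340807352396407310617331613467419645568294338598007387041415740338007833065693846193528742115,
    -101022336902086496371897981488151189957232643458001754254681713807390218629455480671451696685251920879461300425851127960914419197624679806273616782157053233]

theorem bernoulliTable_recurrence : ∀ m < 63, 0 < m →
    2 * ∑ j ∈ Finset.range (m + 1),
      (((2 * m + 1)! / ((2 * j)! * (2 * m + 1 - 2 * j)!) : ℕ) : ℤ) * bernoulliTable.getD j 0 =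
      (2 * m + 1) * bernoulliDenom := by
  decide +kernel

theorem sum_choose_mul_bernoulli_even {m : ℕ} (hm : 0 < m) :
    2 * ∑ j ∈ Finset.range (m + 1), ((2 * m + 1).choose (2 * j) : ℚ) * bernoulli (2 * j) =
      2 * m + 1 := by
  have h := sum_bernoulli (2 * m + 1)
  rw [if_neg (by omega), Finset.sum_range_succ] at h
  have split (n : ℕ) (f : ℕ → ℚ) : ∑ i ∈ Finset.range (2 * n), f i =
      ∑ j ∈ Finset.range n, f (2 * j) + ∑ j ∈ Finset.range n, f (2 * j + 1) := by
    induction n with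
    | zero => simp
    | succ n ih =>
      rw [show 2 * (n + 1) = 2 * n + 1 + 1 by ring, Finset.sum_range_succ, Finset.sum_range_succ,
        ih, Finset.sum_range_succ, Finset.sum_range_succ]
      ring
  have hodd : ∑ j ∈ Finset.range m, ((2 * m + 1).choose (2 * j + 1) : ℚ) * bernoulli (2 * j + 1) =
      -(2 * m + 1) / 2 := by
    rw [Finset.sum_eq_single_of_mem 0 (Finset.mem_range.2 hm)]
    · simp
      ring
    · intro j _ hj
      rw [bernoulli_eq_zero_of_odd ⟨j, rfl⟩ (by omega), mul_zero]
  rw [split, hodd] at h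
  rw [Finset.sum_range_succ]
  linarith

theorem bernoulliDenom_mul_bernoulli (m : ℕ) (hm : m < 63) :
    bernoulliDenom * bernoulli (2 * m) = (bernoulliTable.getD m 0 : ℤ) := by
  induction m using Nat.strong_induction_on with
  | _ m ih =>
    rcases Nat.eq_zero_or_pos m with rfl | hpos
    · rw [mul_zero, bernoulli_zero, mul_one]
      exact_mod_cast (by decide +kernel : (bernoulliDenom : ℤ) = bernoulliTable.getD 0 0)
    · have h₁ := sum_choose_mul_bernoulli_even hpos
      have h₂ := congrArg (Int.cast : ℤ → ℚ) (bernoulliTable_recurrence m hm hpos)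
      have hchoose : ∀ j ∈ Finset.range (m + 1),
          (((2 * m + 1)! / ((2 * j)! * (2 * m + 1 - 2 * j)!) : ℕ) : ℤ) * bernoulliTable.getD j 0 =
            ((2 * m + 1).choose (2 * j) : ℤ) * bernoulliTable.getD j 0 := fun j hj ↦ by
        rw [Nat.choose_eq_factorial_div_factorial (by have := Finset.mem_range.1 hj; omega)]
      rw [Finset.sum_congr rfl hchoose] at h₂
      push_cast at h₂
      rw [Finset.sum_range_succ] at h₁ h₂
      have hlow : ∑ j ∈ Finset.range m,
          ((2 * m + 1).choose (2 * j) : ℚ) * (bernoulliTable.getD j 0 : ℤ) =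
          bernoulliDenom * ∑ j ∈ Finset.range m,
            ((2 * m + 1).choose (2 * j) : ℚ) * bernoulli (2 * j) := by
        rw [Finset.mul_sum]
        refine Finset.sum_congr rfl fun j hj ↦ ?_
        have hj := Finset.mem_range.1 hj
        rw [← ih j hj (by omega)]
        ring
      rw [hlow] at h₂
      have hc : (((2 * m + 1).choose (2 * m) : ℕ) : ℚ) ≠ 0 :=
        Nat.cast_ne_zero.2 (Nat.choose_pos (by omega)).ne'
      refine mul_left_cancel₀ hc ?_
      linear_combination (bernoulliDenom : ℚ) / 2 * h₁ - h₂ / 2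

/-- The value of `sL k` for `k ≤ 62`, computed from `bernoulliTable`. -/
def sLTable (k : ℕ) : ℚ :=
  mkRat (2 ^ (2 * k) * (2 ^ (2 * k - 1) - 1) * (bernoulliTable.getD k 0).natAbs)
    (bernoulliDenom * (2 * k)!)

theorem sL_eq_sLTable {k : ℕ} (hk : k < 63) : sL k = sLTable k := by
  have hD : (0 : ℚ) < bernoulliDenom := by norm_num [bernoulliDenom]
  have hf : ((2 * k)! : ℚ) ≠ 0 := by positivity
  have h : |bernoulli (2 * k)| = ((bernoulliTable.getD k 0).natAbs : ℚ) / bernoulliDenom := by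
    rw [eq_div_iff hD.ne', Nat.cast_natAbs, Int.cast_abs, ← bernoulliDenom_mul_bernoulli k hk,
      abs_mul, abs_of_pos hD, mul_comm]
  rw [sL, sLTable, h, Rat.mkRat_eq_div]
  push_cast [Nat.cast_natAbs]
  field_simp

theorem dvd_of_sLL_mul_sq_add {k N : ℕ} {x y ε : ℤ} (hN : (N : ℤ) ∣ (sL (2 * k)).num)
    (h : sLL k * (x : ℚ) ^ 2 + sL (2 * k) * (y : ℚ) = ε) :
    (N : ℤ) ∣ ((sL k).num * x) ^ 2 - 2 * ε * (sL k).den ^ 2 := by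
  rw [sLL] at h
  set p := sL k
  set q := sL (2 * k)
  have hp : p * p.den = p.num := Rat.mul_den_eq_num p
  have hq : q * q.den = q.num := Rat.mul_den_eq_num q
  have key : (q.den : ℤ) * ((p.num * x) ^ 2 - 2 * ε * p.den ^ 2) =
      q.num * (p.den ^ 2 * (x ^ 2 - 2 * y)) := by
    have : (q.den : ℚ) * ((p.num * x) ^ 2 - 2 * ε * p.den ^ 2) =
        q.num * (p.den ^ 2 * (x ^ 2 - 2 * y)) := by
      rw [← hp, ← hq]
      linear_combination 2 * (p.den : ℚ) ^ 2 * q.den * h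
    exact_mod_cast this
  have hcop : IsCoprime (N : ℤ) q.den := IsCoprime.of_isCoprime_of_dvd_left
    (Int.isCoprime_iff_nat_coprime.2 (by simpa using q.reduced)) hN
  exact hcop.dvd_of_dvd_mul_left (key ▸ hN.mul_right _)

theorem not_dvd_sq_sub_mul_sq_of_jacobiSym {N : ℕ} {c z b : ℤ} (hc : jacobiSym c N = -1)
    (hb : b.gcd N = 1) : ¬ (N : ℤ) ∣ z ^ 2 - c * b ^ 2 := by
  intro h
  have hJ : jacobiSym (z ^ 2) N = jacobiSym (c * b ^ 2) N :=
    jacobiSym.mod_left' (Int.emod_eq_emod_iff_emod_sub_eq_zero.2 (Int.emod_eq_zero_of_dvd h))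
  rw [jacobiSym.mul_left, hc, jacobiSym.sq_one' hb, jacobiSym.pow_left] at hJ
  nlinarith [sq_nonneg (jacobiSym z N)]

theorem sLL_mul_sq_add_ne_of_jacobiSym {k N : ℕ} {ε : ℤ} (hk : k < 32)
    (hN : (N : ℤ) ∣ (sLTable (2 * k)).num) (hb : ((sLTable k).den : ℤ).gcd N = 1)
    (hε : jacobiSym (2 * ε) N = -1) (x y : ℤ) :
    sLL k * (x : ℚ) ^ 2 + sL (2 * k) * (y : ℚ) ≠ ε := by
  intro h
  rw [← sL_eq_sLTable (by omega)] at hN hb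
  exact not_dvd_sq_sub_mul_sq_of_jacobiSym hε hb (dvd_of_sLL_mul_sq_add hN h)

theorem sLL_mul_sq_add_ne_of_four_dvd {k : ℕ} {ε : ℤ} (hk : k < 32)
    (h₂ : 4 ∣ (sLTable (2 * k)).num) (h₁ : 2 ∣ (sLTable k).num)
    (hε : Odd ε) (x y : ℤ) :
    sLL k * (x : ℚ) ^ 2 + sL (2 * k) * (y : ℚ) ≠ ε := by
  intro h
  rw [← sL_eq_sLTable (by omega)] at h₁ h₂
  have hdvd := dvd_of_sLL_mul_sq_add (N := 4) h₂ h
  have hb : Odd ((sL k).den : ℤ) := by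
    rw [← Int.not_even_iff_odd, even_iff_two_dvd]
    intro hd
    have := Nat.dvd_gcd (Int.natCast_dvd_natCast.1 (Int.dvd_natAbs.2 h₁))
      (Int.natCast_dvd_natCast.1 hd)
    rw [(sL k).reduced] at this
    exact absurd this (by norm_num)
  have hsq : (4 : ℤ) ∣ ((sL k).num * x) ^ 2 := pow_dvd_pow_of_dvd (h₁.mul_right x) 2
  obtain ⟨c, hc⟩ := hε.mul (hb.pow (n := 2))
  have := (dvd_sub_right hsq).1 hdvd
  rw [mul_assoc, hc] at this
  omega

theorem jacobiSym_two_mul_one {N : ℕ} (hN : N % 8 = 3 ∨ N % 8 = 5) :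
    jacobiSym (2 * 1) N = -1 := by
  rw [mul_one, jacobiSym.at_two (Nat.odd_iff.2 (by omega)), ZMod.χ₈_nat_eq_if_mod_eight]
  split_ifs <;> omega

theorem jacobiSym_two_mul_neg_one {N : ℕ} (hN : N % 8 = 5 ∨ N % 8 = 7) :
    jacobiSym (2 * -1) N = -1 := by
  rw [mul_neg_one, jacobiSym.at_neg_two (Nat.odd_iff.2 (by omega)), ZMod.χ₈'_nat_eq_if_mod_eight]
  split_ifs <;> omega

theorem four_dvd_sLTable : ∀ k < 32, 17 ≤ k ∧ k ∉ [17, 18, 20, 24] →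
    4 ∣ (sLTable (2 * k)).num ∧ 2 ∣ (sLTable k).num := by
  decide +kernel

/-- The moduli certifying that `s_(k,k) x² + s_(2k) y = 1` is unsolvable. -/
def posModulus : ℕ → ℕ
  | 17 => 101
  | 18 => 5827954961669944110438277244641067365282488301844260429
  | 20 => 10589
  | _ => 211600449597266513097597728109824233673043954389060234150638733420050668349987259

/-- The moduli certifying that `s_(k,k) x² + s_(2k) y = -1` is unsolvable. -/
def negModulus : ℕ → ℕ
  | 17 => 101
  | 18 => 5827954961669944110438277244641067365282488301844260429
  | 20 => 10589
  | _ => 191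

theorem posModulus_spec : ∀ k ∈ [17, 18, 20, 24],
    (posModulus k : ℤ) ∣ (sLTable (2 * k)).num ∧
    ((sLTable k).den : ℤ).gcd (posModulus k) = 1 ∧
    (posModulus k % 8 = 3 ∨ posModulus k % 8 = 5) := by
  decide +kernel

theorem negModulus_spec : ∀ k ∈ [17, 18, 20, 24],
    (negModulus k : ℤ) ∣ (sLTable (2 * k)).num ∧
    ((sLTable k).den : ℤ).gcd (negModulus k) = 1 ∧
    (negModulus k % 8 = 5 ∨ negModulus k % 8 = 7) := by
  decide +kernel

/-- For `17 ≤ k ≤ 31`, the signature equation `s_(k,k) x² + s_(2k) y = ±1` has no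
integer solutions: there is no rational projective plane in dimension `n` for
`128 < n < 256`. -/
theorem no_solution_dim_between_128_and_256 (k : ℕ) (h17 : 17 ≤ k) (h31 : k ≤ 31) :
    ¬ ∃ x y : ℤ, sLL k * (x : ℚ) ^ 2 + sL (2 * k) * (y : ℚ) = 1 ∨
      sLL k * (x : ℚ) ^ 2 + sL (2 * k) * (y : ℚ) = -1 := by
  rintro ⟨x, y, h⟩
  have h' : sLL k * (x : ℚ) ^ 2 + sL (2 * k) * (y : ℚ) = (1 : ℤ) ∨
      sLL k * (x : ℚ) ^ 2 + sL (2 * k) * (y : ℚ) = (-1 : ℤ) := by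
    exact_mod_cast h
  have hk : k < 32 := by omega
  by_cases hw : k ∈ [17, 18, 20, 24]
  · obtain ⟨hp₁, hp₂, hp₃⟩ := posModulus_spec k hw
    obtain ⟨hn₁, hn₂, hn₃⟩ := negModulus_spec k hw
    exact h'.elim
      (sLL_mul_sq_add_ne_of_jacobiSym hk hp₁ hp₂ (jacobiSym_two_mul_one hp₃) x y)
      (sLL_mul_sq_add_ne_of_jacobiSym hk hn₁ hn₂ (jacobiSym_two_mul_neg_one hn₃) x y)
  · obtain ⟨h₂, h₁⟩ := four_dvd_sLTable k hk ⟨h17, hw⟩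
    exact h'.elim
      (sLL_mul_sq_add_ne_of_four_dvd hk h₂ h₁ odd_one x y)
      (sLL_mul_sq_add_ne_of_four_dvd hk h₂ h₁ odd_neg_one x y)
end

section
/- There are no integers x and y such that s_{2048,2048}·x² + s_{4096}·y = 1 or s_{2048,2048}·x² + s_{4096}·y = −1. (This is the arithmetic content of the nonexistence of a rational projective plane in dimension 2^14 = 16384, witnessed by the prime 502261, which is congruent to 5 mod 8 and divides the numerator of B_{8192} but not the numerator of B_{4096}.) -/
open Nat

/-- Splitting of a power sum over a complete residue system under multiplication by `a`:
a form of Voronoi's congruence. -/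
theorem voronoi_congruence {p a k s : ℕ} [Fact p.Prime] (ha : a.Coprime p)
    (hs : ∑ j ∈ Finset.range p, j ^ k = p * s) :
    ((a : ZMod p) ^ k - 1) * s =
      k * (a : ZMod p) ^ (k - 1) *
        ∑ j ∈ Finset.range p, ((a * j / p : ℕ) : ZMod p) * (j : ZMod p) ^ (k - 1) := by
  have hp : 0 < p := (Fact.out : p.Prime).pos
  have hinj : Set.InjOn (fun j => a * j % p) (Finset.range p : Set ℕ) := by
    intro i hi j hj hij
    simp only [Finset.coe_range, Set.mem_Iio] at hi hj
    have h : i ≡ j [MOD p] := Nat.ModEq.cancel_left_of_coprime ha.symm hij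
    exact h.eq_of_lt_of_lt hi hj
  have himage : (Finset.range p).image (fun j => a * j % p) = Finset.range p := by
    refine Finset.eq_of_subset_of_card_le ?_ (Finset.card_image_of_injOn hinj).ge
    intro x hx
    obtain ⟨j, -, rfl⟩ := Finset.mem_image.mp hx
    exact Finset.mem_range.mpr (Nat.mod_lt _ hp)
  have hperm : ∑ j ∈ Finset.range p, (a * j % p) ^ k = p * s := by
    rw [← hs]
    conv_rhs => rw [← himage]
    rw [Finset.sum_image hinj]
  have hexp : ∀ j : ℕ, ∃ c : ℤ, ((a * j % p : ℕ) : ℤ) ^ k =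
      (a : ℤ) ^ k * (j : ℤ) ^ k
        - p * (k * (a : ℤ) ^ (k - 1) * (((a * j / p : ℕ) : ℤ) * (j : ℤ) ^ (k - 1)))
        + p ^ 2 * c := by
    intro j
    obtain ⟨c, hc⟩ := Polynomial.powAddExpansion ((a : ℤ) * j) (-(p * ((a * j / p : ℕ) : ℤ))) k
    refine ⟨c * ((a * j / p : ℕ) : ℤ) ^ 2, ?_⟩
    have hmod : ((a * j % p : ℕ) : ℤ) = (a : ℤ) * j + -(p * ((a * j / p : ℕ) : ℤ)) := by
      have := Nat.mod_add_div (a * j) p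
      zify at this ⊢
      linarith
    rw [hmod, hc, mul_pow, mul_pow]
    ring
  choose c hc using hexp
  have hsum : (p : ℤ) * s = p * (a ^ k * s
      - k * (a : ℤ) ^ (k - 1) *
        (∑ j ∈ Finset.range p, ((a * j / p : ℕ) : ℤ) * (j : ℤ) ^ (k - 1))
      + p * ∑ j ∈ Finset.range p, c j) := by
    have h1 : (∑ j ∈ Finset.range p, ((a * j % p : ℕ) : ℤ) ^ k) = p * s := by
      exact_mod_cast hperm
    have h2 : (∑ j ∈ Finset.range p, (j : ℤ) ^ k) = p * s := by exact_mod_cast hs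
    rw [← h1]
    simp only [hc, Finset.sum_add_distrib, Finset.sum_sub_distrib, ← Finset.mul_sum, h2]
    ring
  have hcancel := mul_left_cancel₀ (Int.natCast_ne_zero.mpr hp.ne') hsum
  have hz := congrArg (Int.cast : ℤ → ZMod p) hcancel
  simp only [Int.cast_add, Int.cast_sub, Int.cast_mul, Int.cast_pow, Int.cast_sum,
    Int.cast_natCast, CharP.cast_eq_zero] at hz
  linear_combination -hz

/-- Combination of Voronoi's congruences for the multipliers `3`, `4` and `6`. -/
theorem dvd_of_floor_sum_relation {p k e s : ℕ} [Fact p.Prime] (h2 : Nat.Coprime 2 p)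
    (h3 : Nat.Coprime 3 p) (hk : k = e + 1) (hs : ∑ j ∈ Finset.range p, j ^ k = p * s)
    (hrel : (∑ j ∈ Finset.range p, ((6 * j / p : ℕ) : ZMod p) * (j : ZMod p) ^ e) =
      (∑ j ∈ Finset.range p, ((3 * j / p : ℕ) : ZMod p) * (j : ZMod p) ^ e) +
      ∑ j ∈ Finset.range p, ((4 * j / p : ℕ) : ZMod p) * (j : ZMod p) ^ e)
    (hne : ¬ 6 ^ k * 3 ^ e * 4 ^ e + 6 ^ e * 4 ^ e + 6 ^ e * 3 ^ e ≡
      3 ^ e * 4 ^ e + 3 ^ k * 6 ^ e * 4 ^ e + 4 ^ k * 6 ^ e * 3 ^ e [MOD p]) :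
    p ∣ s := by
  have e3 := voronoi_congruence h3 hs
  have e4 := voronoi_congruence (show Nat.Coprime 4 p from h2.mul_left h2) hs
  have e6 := voronoi_congruence (show Nat.Coprime 6 p from h2.mul_left h3) hs
  rw [show k - 1 = e by omega] at e3 e4 e6
  rw [hrel] at e6
  simp only [Nat.cast_ofNat] at e3 e4 e6
  rw [← ZMod.natCast_eq_zero_iff]
  rw [← ZMod.natCast_eq_natCast_iff, ← sub_eq_zero] at hne
  refine (_root_.mul_eq_zero.mp ?_).resolve_left hne
  push_cast
  linear_combination (3 : ZMod p) ^ e * 4 ^ e * e6 - (6 : ZMod p) ^ e * 4 ^ e * e3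
    - (6 : ZMod p) ^ e * 3 ^ e * e4

/-- If the weights `⌊6j/p⌋ - ⌊3j/p⌋ - ⌊4j/p⌋` are the difference of the indicator functions of
`[a, b)` and of its reflection, and the odd power sum over `[a, b)` vanishes, then the weighted
power sum vanishes. -/
theorem floor_sum_relation {p e a b : ℕ} (he : Odd e) (ha : 0 < a) (hb : b ≤ p)
    (hw : ∀ j < p, 6 * j / p + (if j ∈ Finset.Ico (p + 1 - b) (p + 1 - a) then 1 else 0) =
      3 * j / p + 4 * j / p + (if j ∈ Finset.Ico a b then 1 else 0))
    (h0 : ∑ j ∈ Finset.Ico a b, (j : ZMod p) ^ e = 0) :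
    (∑ j ∈ Finset.range p, ((6 * j / p : ℕ) : ZMod p) * (j : ZMod p) ^ e) =
      (∑ j ∈ Finset.range p, ((3 * j / p : ℕ) : ZMod p) * (j : ZMod p) ^ e) +
      ∑ j ∈ Finset.range p, ((4 * j / p : ℕ) : ZMod p) * (j : ZMod p) ^ e := by
  have hsum : ∑ j ∈ Finset.range p, (((6 * j / p : ℕ) : ZMod p) * (j : ZMod p) ^ e
        + (if j ∈ Finset.Ico (p + 1 - b) (p + 1 - a) then (j : ZMod p) ^ e else 0)) =
      ∑ j ∈ Finset.range p, (((3 * j / p : ℕ) : ZMod p) * (j : ZMod p) ^ e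
        + ((4 * j / p : ℕ) : ZMod p) * (j : ZMod p) ^ e
        + (if j ∈ Finset.Ico a b then (j : ZMod p) ^ e else 0)) := by
    refine Finset.sum_congr rfl fun j hj => ?_
    have h := congrArg (fun n : ℕ => (n : ZMod p) * (j : ZMod p) ^ e)
      (hw j (Finset.mem_range.mp hj))
    simpa only [Nat.cast_add, Nat.cast_ite, Nat.cast_one, Nat.cast_zero, add_mul, ite_mul,
      one_mul, zero_mul] using h
  have hsub {c d : ℕ} (hd : d ≤ p) : Finset.range p ∩ Finset.Ico c d = Finset.Ico c d := by
    ext j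
    simp only [Finset.mem_inter, Finset.mem_range, Finset.mem_Ico]
    omega
  have hreflect : ∑ j ∈ Finset.Ico (p + 1 - b) (p + 1 - a), (j : ZMod p) ^ e = 0 := by
    rw [← Finset.sum_Ico_reflect (fun j : ℕ => (j : ZMod p) ^ e) a (by omega), ← neg_eq_zero,
      ← h0, ← Finset.sum_neg_distrib]
    refine Finset.sum_congr rfl fun j hj => ?_
    rw [Finset.mem_Ico] at hj
    rw [Nat.cast_sub (by omega), CharP.cast_eq_zero, zero_sub, he.neg_pow, neg_neg]
  rwa [Finset.sum_add_distrib, Finset.sum_add_distrib, Finset.sum_add_distrib,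
    Finset.sum_ite_mem, Finset.sum_ite_mem, hsub (by omega), hsub hb, hreflect, h0,
    add_zero, add_zero] at hsum

/-- The localization of `ℤ` at the prime `p`, as a subring of `ℚ`. -/
noncomputable def rationalPadicIntegers (p : ℕ) [Fact p.Prime] : Subring ℚ :=
  (PadicInt.subring p).comap (Rat.castHom ℚ_[p])

namespace rationalPadicIntegers

variable {p : ℕ} [Fact p.Prime]

theorem mem_iff {q : ℚ} : q ∈ rationalPadicIntegers p ↔ ‖(q : ℚ_[p])‖ ≤ 1 := Iff.rfl

theorem inv_natCast_mem {n : ℕ} (hn : ¬ p ∣ n) : (n : ℚ)⁻¹ ∈ rationalPadicIntegers p := by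
  have h : ‖(n : ℚ_[p])‖ = 1 := by
    rw [Padic.norm_natCast_eq_one_iff]
    exact ((Fact.out : p.Prime).coprime_iff_not_dvd).mpr hn
  rw [mem_iff]
  push_cast
  rw [norm_inv, h, inv_one]

theorem div_natCast_mem {q : ℚ} {n : ℕ} (hq : q ∈ rationalPadicIntegers p) (hn : ¬ p ∣ n) :
    q / n ∈ rationalPadicIntegers p := by
  rw [div_eq_mul_inv]
  exact mul_mem hq (inv_natCast_mem hn)

theorem abs_mem {q : ℚ} (hq : q ∈ rationalPadicIntegers p) : |q| ∈ rationalPadicIntegers p := by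
  rcases abs_choice q with h | h <;> rw [h]
  exacts [hq, neg_mem hq]

theorem dvd_of_natCast_eq_mul {n : ℕ} {c : ℚ} (hc : c ∈ rationalPadicIntegers p)
    (h : (n : ℚ) = p * c) : p ∣ n := by
  have hp : (1 : ℝ) < p := by exact_mod_cast (Fact.out : p.Prime).one_lt
  have hnorm : ‖((n : ℤ) : ℚ_[p])‖ < 1 := by
    have h' : ((n : ℤ) : ℚ_[p]) = p * (c : ℚ_[p]) := by
      have := congrArg (Rat.cast : ℚ → ℚ_[p]) h
      push_cast at this ⊢
      exact this
    rw [h', norm_mul, Padic.norm_p]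
    calc (p : ℝ)⁻¹ * ‖(c : ℚ_[p])‖ ≤ (p : ℝ)⁻¹ * 1 := by
          gcongr
          exact mem_iff.mp hc
      _ < 1 := by rw [mul_one]; exact inv_lt_one_of_one_lt₀ hp
  exact_mod_cast (Padic.norm_intCast_lt_one_iff).mp hnorm

theorem bernoulli'_mem {n : ℕ} (hn : n + 1 < p) : bernoulli' n ∈ rationalPadicIntegers p := by
  induction n using Nat.strong_induction_on with
  | _ n ih =>
    rw [bernoulli'_def]
    refine sub_mem (one_mem _) (sum_mem fun k hk => ?_)
    rw [Finset.mem_range] at hk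
    refine mul_mem ?_ (ih k hk (by omega))
    have hcast : ((n : ℚ) - k + 1) = ((n - k + 1 : ℕ) : ℚ) := by
      push_cast [Nat.cast_sub hk.le]
      ring
    rw [hcast]
    exact div_natCast_mem (natCast_mem _ _) (Nat.not_dvd_of_pos_of_lt (by omega) (by omega))

theorem bernoulli_mem {n : ℕ} (hn : n + 1 < p) : bernoulli n ∈ rationalPadicIntegers p := by
  rw [bernoulli]
  exact mul_mem (pow_mem (neg_mem (one_mem _)) _) (bernoulli'_mem hn)

theorem exists_sum_pow_eq {k : ℕ} (hk : k + 1 < p) :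
    ∃ c ∈ rationalPadicIntegers p,
      ((∑ j ∈ Finset.range p, j ^ k : ℕ) : ℚ) = p * (bernoulli k + p * c) := by
  have hunit : ((k + 1 : ℕ) : ℚ) ≠ 0 := by positivity
  refine ⟨∑ i ∈ Finset.range k,
    bernoulli i * ((k + 1).choose i : ℚ) * (p : ℚ) ^ (k - 1 - i) / (k + 1 : ℕ), ?_, ?_⟩
  · refine sum_mem fun i hi => ?_
    rw [Finset.mem_range] at hi
    exact div_natCast_mem
      (mul_mem (mul_mem (bernoulli_mem (by omega)) (natCast_mem _ _))
        (pow_mem (natCast_mem _ _) _))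
      (Nat.not_dvd_of_pos_of_lt (by omega) hk)
  · push_cast
    rw [sum_range_pow, Finset.sum_range_succ, mul_add, add_comm, Finset.mul_sum, Finset.mul_sum]
    congr 1
    · rw [Nat.choose_succ_self_right, Nat.add_sub_cancel_left, pow_one]
      push_cast at hunit ⊢
      field_simp
    · refine Finset.sum_congr rfl fun i hi => ?_
      rw [Finset.mem_range] at hi
      rw [show k + 1 - i = k - 1 - i + 2 by omega, pow_add]
      ring

/-- `sL k` is `p`-integral for every prime `p > 2k + 1`. -/
theorem sL_mem {k : ℕ} (hk : 2 * k + 1 < p) : sL k ∈ rationalPadicIntegers p := by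
  rw [sL]
  refine div_natCast_mem (mul_mem (mul_mem (pow_mem (ofNat_mem _ 2) _)
    (sub_mem (pow_mem (ofNat_mem _ 2) _) (one_mem _))) (abs_mem (bernoulli_mem hk))) ?_
  rw [(Fact.out : p.Prime).dvd_factorial]
  omega

/-- If `p > 2k + 1` divides the numerator of `B_(2k)`, then it divides that of `sL k`. -/
theorem exists_sL_eq {k : ℕ} (hk : 2 * k + 1 < p) {b : ℚ} (hb : b ∈ rationalPadicIntegers p)
    (h : bernoulli (2 * k) = p * b) : ∃ r ∈ rationalPadicIntegers p, sL k = p * r := by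
  refine ⟨2 ^ (2 * k) * (2 ^ (2 * k - 1) - 1) * |b| / ((2 * k)! : ℕ),
    div_natCast_mem (mul_mem (mul_mem (pow_mem (ofNat_mem _ 2) _)
      (sub_mem (pow_mem (ofNat_mem _ 2) _) (one_mem _))) (abs_mem hb)) ?_, ?_⟩
  · rw [(Fact.out : p.Prime).dvd_factorial]
    omega
  · rw [sL, h, abs_mul, Nat.abs_cast]
    ring

/-- A prime dividing `s_(2k)` at which `s_k` is integral forces `2` or `-2` to be a square. -/
theorem isSquare_of_solution {k : ℕ} (hk : 2 * k + 1 < p) {r : ℚ}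
    (hr : r ∈ rationalPadicIntegers p) (h : sL (2 * k) = p * r) {x y ε : ℤ}
    (heq : sLL k * (x : ℚ) ^ 2 + sL (2 * k) * (y : ℚ) = ε) : IsSquare (2 * ε : ZMod p) := by
  let S : ℤ_[p] := ⟨(sL k : ℚ_[p]), sL_mem hk⟩
  let R : ℤ_[p] := ⟨(r : ℚ_[p]), hr⟩
  have hq : sL k ^ 2 * (x : ℚ) ^ 2 - p * r * x ^ 2 + 2 * (p * r * y) = 2 * ε := by
    rw [← heq, sLL, h]
    ring
  have hz : S ^ 2 * (x : ℤ_[p]) ^ 2 - p * R * x ^ 2 + 2 * (p * R * y) = 2 * (ε : ℤ_[p]) := by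
    apply PadicInt.ext
    have := congrArg (Rat.cast : ℚ → ℚ_[p]) hq
    push_cast at this ⊢
    exact this
  have hF := congrArg (PadicInt.toZMod (p := p)) hz
  simp only [map_add, map_sub, map_mul, map_pow, map_natCast, map_intCast, map_ofNat,
    CharP.cast_eq_zero] at hF
  exact ⟨PadicInt.toZMod S * x, by linear_combination -hF⟩

end rationalPadicIntegers

/-- `∑ i < n, f i`, in a form that the kernel evaluates efficiently. -/
def kernelSum (f : ℕ → ℕ) (n : ℕ) : ℕ :=
  Nat.rec 0 (fun i acc => Nat.add acc (f i)) n

theorem kernelSum_eq (f : ℕ → ℕ) (n : ℕ) : kernelSum f n = ∑ i ∈ Finset.range n, f i := by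
  induction n with
  | zero => rfl
  | succ n ih => rw [Finset.sum_range_succ, ← ih]; rfl

theorem sum_range_mul (f : ℕ → ℕ) (m n : ℕ) :
    ∑ i ∈ Finset.range (m * n), f i =
      ∑ b ∈ Finset.range n, ∑ i ∈ Finset.range m, f (m * b + i) := by
  induction n with
  | zero => simp
  | succ n ih => rw [Nat.mul_succ, Finset.sum_range_add, ih, Finset.sum_range_succ]

theorem sum_Ico_add_mul_eq_kernelSum (f : ℕ → ℕ) (a m n : ℕ) :
    ∑ j ∈ Finset.Ico a (a + m * n), f j =
      kernelSum (fun b => kernelSum (fun i => f (Nat.add a (Nat.add (Nat.mul m b) i))) m) n := by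
  rw [Finset.sum_Ico_eq_sum_range, Nat.add_sub_cancel_left, sum_range_mul]
  simp only [kernelSum_eq]
  rfl

theorem sum_Ico_cast_eq_zero_of_dvd_kernelSum {p a b m n : ℕ} {f : ℕ → ℕ}
    (hb : b = a + m * n)
    (h : p ∣ kernelSum (fun b => kernelSum
      (fun i => f (Nat.add a (Nat.add (Nat.mul m b) i))) m) n) :
    ∑ j ∈ Finset.Ico a b, (f j : ZMod p) = 0 := by
  rwa [← sum_Ico_add_mul_eq_kernelSum, ← hb, ← ZMod.natCast_eq_zero_iff, Nat.cast_sum] at h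

instance fact_prime_502261 : Fact (Nat.Prime 502261) := ⟨by norm_num⟩

/-- A representative of `j ^ 8191` modulo `502261`. -/
def powMod (j : ℕ) : ℕ :=
  Nat.mod (Nat.mul (Nat.pow (Nat.mod (Nat.pow (Nat.mod (Nat.pow j 15) 502261) 21) 502261) 26) j)
    502261

theorem powMod_eq (j : ℕ) :
    powMod j = ((j ^ 15 % 502261) ^ 21 % 502261) ^ 26 * j % 502261 := rfl

theorem natCast_powMod (j : ℕ) : (powMod j : ZMod 502261) = (j : ZMod 502261) ^ 8191 := by
  rw [powMod_eq]
  simp only [ZMod.natCast_mod, Nat.cast_mul, Nat.cast_pow]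
  rw [← pow_mul, ← pow_mul, ← pow_succ]

theorem dvd_kernelSum_powMod :
    502261 ∣ kernelSum (fun b => kernelSum (fun i =>
      powMod (Nat.add 83711 (Nat.add (Nat.mul 761 b) i))) 761) 55 := by
  decide +kernel

theorem sum_powMod_eq_zero :
    ∑ j ∈ Finset.Ico (83711 : ℕ) 125566, (powMod j : ZMod 502261) = 0 :=
  sum_Ico_cast_eq_zero_of_dvd_kernelSum (by norm_num) dvd_kernelSum_powMod

theorem sum_pow_8191_eq_zero :
    ∑ j ∈ Finset.Ico (83711 : ℕ) 125566, (j : ZMod 502261) ^ 8191 = 0 := by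
  rw [← sum_powMod_eq_zero]
  exact Finset.sum_congr rfl fun j _ => (natCast_powMod j).symm

theorem floor_6_eq_floor_3_add_floor_4 {j : ℕ} (hj : j < 502261) :
    6 * j / 502261 + (if j ∈ Finset.Ico (502261 + 1 - 125566) (502261 + 1 - 83711) then 1 else 0) =
      3 * j / 502261 + 4 * j / 502261 + (if j ∈ Finset.Ico 83711 125566 then 1 else 0) := by
  simp only [Finset.mem_Ico]
  obtain ⟨q₆, h₆⟩ : ∃ q, q = 6 * j / 502261 := ⟨_, rfl⟩
  obtain ⟨q₃, h₃⟩ : ∃ q, q = 3 * j / 502261 := ⟨_, rfl⟩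
  obtain ⟨q₄, h₄⟩ : ∃ q, q = 4 * j / 502261 := ⟨_, rfl⟩
  have hq₆ : q₆ ≤ 5 := by omega
  have hq₃ : q₃ ≤ 2 := by omega
  have hq₄ : q₄ ≤ 3 := by omega
  rw [← h₆, ← h₃, ← h₄]
  interval_cases q₆ <;> interval_cases q₃ <;> interval_cases q₄ <;> split_ifs <;> omega

set_option exponentiation.threshold 10000 in
/-- The prime `502261` divides the numerator of `B_8192`. -/
theorem exists_bernoulli_8192_eq :
    ∃ b ∈ rationalPadicIntegers 502261, bernoulli 8192 = (502261 : ℕ) * b := by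
  obtain ⟨c, hc, hS⟩ :=
    rationalPadicIntegers.exists_sum_pow_eq (p := 502261) (k := 8192) (by norm_num)
  have hB : bernoulli 8192 ∈ rationalPadicIntegers 502261 :=
    rationalPadicIntegers.bernoulli_mem (by norm_num)
  have hint := add_mem hB (mul_mem (natCast_mem _ 502261) hc)
  obtain ⟨s, hs⟩ := rationalPadicIntegers.dvd_of_natCast_eq_mul hint hS
  have hdvd := dvd_of_floor_sum_relation (by norm_num) (by norm_num) rfl hs
    (floor_sum_relation (by decide) (by norm_num) (by norm_num)
      (fun _ => floor_6_eq_floor_3_add_floor_4) sum_pow_8191_eq_zero)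
    (by decide +kernel)
  obtain ⟨t, rfl⟩ := hdvd
  refine ⟨t - c, sub_mem (natCast_mem _ _) hc, ?_⟩
  rw [hs, Nat.cast_mul] at hS
  have := mul_left_cancel₀ (Nat.cast_ne_zero.mpr (by norm_num)) hS
  rw [Nat.cast_mul] at this
  linear_combination -this

/-- There is no integer solution of the signature equation in dimension `2^14 = 16384`:
`s_(2048,2048) x² + s_4096 y = ±1` has no integer solutions. -/
theorem no_solution_dim_16384 :
    ¬ ∃ x y : ℤ, sLL 2048 * (x : ℚ) ^ 2 + sL 4096 * (y : ℚ) = 1 ∨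
      sLL 2048 * (x : ℚ) ^ 2 + sL 4096 * (y : ℚ) = -1 := by
  obtain ⟨b, hb, hB⟩ := exists_bernoulli_8192_eq
  obtain ⟨r, hr, hL⟩ := rationalPadicIntegers.exists_sL_eq (p := 502261) (k := 4096)
    (by norm_num) hb hB
  have hsq : ∀ x y ε : ℤ, sLL 2048 * (x : ℚ) ^ 2 + sL 4096 * (y : ℚ) = ε →
      IsSquare (2 * ε : ZMod 502261) := fun x y ε h =>
    rationalPadicIntegers.isSquare_of_solution (k := 2048) (by norm_num) hr hL h
  rintro ⟨x, y, h | h⟩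
  · have h2 := hsq x y 1 (by rw [h, Int.cast_one])
    rw [Int.cast_one, mul_one, ZMod.exists_sq_eq_two_iff (by norm_num)] at h2
    norm_num at h2
  · have h2 := hsq x y (-1) (by rw [h, Int.cast_neg, Int.cast_one])
    rw [Int.cast_neg, Int.cast_one, mul_neg, mul_one,
      ZMod.exists_sq_eq_neg_two_iff (by norm_num)] at h2
    norm_num at h2
end
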